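/- arXiv:2506.12410 — 6 statements merged into one kernel-verified Lean document; each statement's English description precedes it below -/
import Mathlib

section
/- Let N ≥ 1 be an integer, β > 0, Δt > 0, and let ω > 0 be a frequency such that sin(ω·Δt) ≠ 0 (i.e., ω·Δt is not an integer multiple of π). Then the fixed-frequency two-point correlation matrix 𝓑(ω) has rank exactly 2. -/
open scoped BigOperators

/-- The fixed-frequency two-point correlation matrix `𝓑(ω)`, a `(2N+1)×(2N+1)` complex
matrix indexed by `k₁, k₂ ∈ {-N, …, N}`, with entries
`coth(βω/2)·cos(ω·Δk·Δt) − i·sin(ω·Δk·Δt)` where `Δk = |k₁| − |k₂|`. -/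
noncomputable def fixedFreqTPC (N : ℕ) (β Δt ω : ℝ) :
    Matrix (Finset.Icc (-(N : ℤ)) (N : ℤ)) (Finset.Icc (-(N : ℤ)) (N : ℤ)) ℂ :=
  fun k₁ k₂ =>
    (((Real.cosh (β * ω / 2) / Real.sinh (β * ω / 2)) *
        Real.cos (ω * ((|(k₁ : ℤ)| - |(k₂ : ℤ)| : ℤ) : ℝ) * Δt) : ℝ) : ℂ) -
      Complex.I * ((Real.sin (ω * ((|(k₁ : ℤ)| - |(k₂ : ℤ)| : ℤ) : ℝ) * Δt) : ℝ) : ℂ)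

/-- The fixed-frequency correlation matrix factors through a two-dimensional space, by the
angle-subtraction formulas. -/
theorem fixedFreqTPC_eq_mul (N : ℕ) (β Δt ω : ℝ) :
    fixedFreqTPC N β Δt ω =
      (Matrix.of fun k : Finset.Icc (-(N : ℤ)) (N : ℤ) => ![(Real.cos (ω * |((k : ℤ) : ℝ)| * Δt) : ℂ),
        (Real.sin (ω * |((k : ℤ) : ℝ)| * Δt) : ℂ)]) *
      (Matrix.of fun k : Finset.Icc (-(N : ℤ)) (N : ℤ) => ![
        ((Real.cosh (β * ω / 2) / Real.sinh (β * ω / 2) : ℝ) : ℂ) *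
            (Real.cos (ω * |((k : ℤ) : ℝ)| * Δt) : ℂ) +
          Complex.I * (Real.sin (ω * |((k : ℤ) : ℝ)| * Δt) : ℂ),
        ((Real.cosh (β * ω / 2) / Real.sinh (β * ω / 2) : ℝ) : ℂ) *
            (Real.sin (ω * |((k : ℤ) : ℝ)| * Δt) : ℂ) -
          Complex.I * (Real.cos (ω * |((k : ℤ) : ℝ)| * Δt) : ℂ)]).transpose := by
  ext k₁ k₂
  have h : ω * ((|(k₁ : ℤ)| - |(k₂ : ℤ)| : ℤ) : ℝ) * Δt =
      ω * |((k₁ : ℤ) : ℝ)| * Δt - ω * |((k₂ : ℤ) : ℝ)| * Δt := by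
    push_cast; ring
  rw [fixedFreqTPC, h, Real.cos_sub, Real.sin_sub, Matrix.mul_apply, Fin.sum_univ_two]
  simp only [Matrix.of_apply, Matrix.transpose_apply, Matrix.cons_val_zero, Matrix.cons_val_one,
    Complex.ofReal_mul, Complex.ofReal_add, Complex.ofReal_sub]
  ring

/-- The fixed-frequency correlation matrix has rank at most two. -/
theorem rank_fixedFreqTPC_le_two (N : ℕ) (β Δt ω : ℝ) :
    (fixedFreqTPC N β Δt ω).rank ≤ 2 := by
  rw [fixedFreqTPC_eq_mul]
  exact (Matrix.rank_mul_le_left _ _).trans (Matrix.rank_le_card_width _)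

/-- The minor on the indices `0, 1` equals `sin² (ω Δt) / sinh² (β ω / 2)`. -/
theorem fixedFreqTPC_minor (N : ℕ) (β Δt ω : ℝ) (hs : Real.sinh (β * ω / 2) ≠ 0)
    (k₀ k₁ : Finset.Icc (-(N : ℤ)) (N : ℤ)) (h₀ : (k₀ : ℤ) = 0) (h₁ : (k₁ : ℤ) = 1) :
    ((fixedFreqTPC N β Δt ω).submatrix ![k₀, k₁] ![k₀, k₁]).det =
      ((Real.sin (ω * Δt) ^ 2 / Real.sinh (β * ω / 2) ^ 2 : ℝ) : ℂ) := by
  have key : Real.sin (ω * Δt) ^ 2 / Real.sinh (β * ω / 2) ^ 2 =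
      (Real.cosh (β * ω / 2) / Real.sinh (β * ω / 2)) ^ 2 * (1 - Real.cos (ω * Δt) ^ 2) -
        Real.sin (ω * Δt) ^ 2 := by
    rw [← Real.sin_sq, div_pow, Real.cosh_sq, add_div, div_self (pow_ne_zero 2 hs)]
    ring
  rw [key, Matrix.det_fin_two]
  simp only [Matrix.submatrix_apply, Matrix.cons_val_zero, Matrix.cons_val_one, fixedFreqTPC,
    h₀, h₁, abs_zero, abs_one, sub_self, zero_sub, sub_zero, Int.cast_zero, Int.cast_one,
    Int.cast_neg, mul_zero, zero_mul, mul_one, mul_neg, neg_mul, Real.cos_neg, Real.sin_neg,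
    Real.cos_zero, Real.sin_zero, Complex.ofReal_zero, Complex.ofReal_neg, Complex.ofReal_mul,
    Complex.ofReal_sub, Complex.ofReal_pow, Complex.ofReal_one]
  linear_combination ((Real.sin (ω * Δt) : ℝ) : ℂ) ^ 2 * Complex.I_sq

/-- for `N ≥ 1`, `β > 0`, `Δt > 0`, `ω > 0` with `sin(ω·Δt) ≠ 0`,
the matrix `𝓑(ω)` has rank exactly 2. -/
theorem fixedFreqTPC_rank_eq_two (N : ℕ) (hN : 1 ≤ N) (β Δt ω : ℝ)
    (hβ : 0 < β) (hΔt : 0 < Δt) (hω : 0 < ω)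
    (hsin : Real.sin (ω * Δt) ≠ 0) :
    (fixedFreqTPC N β Δt ω).rank = 2 := by
  have hs : Real.sinh (β * ω / 2) ≠ 0 := (Real.sinh_pos_iff.mpr (by positivity)).ne'
  have hdet := fixedFreqTPC_minor N β Δt ω hs ⟨0, by simp⟩
    ⟨1, by rw [Finset.mem_Icc]; omega⟩ rfl rfl
  refine le_antisymm (rank_fixedFreqTPC_le_two N β Δt ω) ?_
  have hunit := (Matrix.isUnit_iff_isUnit_det _).mpr (isUnit_iff_ne_zero.mpr
    (hdet.trans_ne (Complex.ofReal_ne_zero.mpr (by positivity))))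
  have hrank := Matrix.rank_of_isUnit _ hunit
  rw [Fintype.card_fin] at hrank
  exact hrank.symm.trans_le (Matrix.rank_submatrix_le _ _ _)
end

section
/- Let N ≥ 1 be an integer, β > 0, Δt > 0 and ω > 0. Define vectors x, y ∈ ℂ^{2N+1}, indexed by k ∈ {−N, …, N}, by x_k = e^{i·ω·|k|·Δt} and y_k = e^{−i·ω·|k|·Δt}. Then the fixed-frequency two-point correlation matrix admits the decomposition 𝓑(ω) = (1/2)(coth(βω/2) − 1)·x x† + (1/2)(coth(βω/2) + 1)·y y†, where x x† denotes the outer product matrix with entries x_{k₁}·conj(x_{k₂}). -/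
open scoped BigOperators

/-- The product of the phase `exp (i ω a t)` with the conjugate of `exp (i ω b t)`. -/
theorem exp_mul_conj_exp_phase (ω a b t : ℝ) :
    Complex.exp (Complex.I * ω * a * t) * starRingEnd ℂ (Complex.exp (Complex.I * ω * b * t)) =
      Complex.cos (ω * (a - b) * t) + Complex.sin (ω * (a - b) * t) * Complex.I := by
  rw [← Complex.exp_mul_I, ← Complex.exp_conj, ← Complex.exp_add]
  simp only [map_mul, Complex.conj_I, Complex.conj_ofReal]
  congr 1
  ring

/-- The product of the phase `exp (-i ω a t)` with the conjugate of `exp (-i ω b t)`. -/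
theorem exp_neg_mul_conj_exp_neg_phase (ω a b t : ℝ) :
    Complex.exp (-(Complex.I * ω * a * t)) *
        starRingEnd ℂ (Complex.exp (-(Complex.I * ω * b * t))) =
      Complex.cos (ω * (a - b) * t) - Complex.sin (ω * (a - b) * t) * Complex.I := by
  simpa [sub_eq_add_neg, ← neg_add] using exp_mul_conj_exp_phase (-ω) a b t

/-- the rank-2 decomposition of the fixed-frequency two-point correlation
matrix: 𝓑(ω) = ½(coth(βω/2) − 1)·x x† + ½(coth(βω/2) + 1)·y y†, where
x_k = e^{iω|k|Δt} and y_k = e^{−iω|k|Δt}. -/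
theorem fixedFreqTPC_decomposition (N : ℕ) (hN : 1 ≤ N) (β Δt ω : ℝ)
    (hβ : 0 < β) (hΔt : 0 < Δt) (hω : 0 < ω) :
    fixedFreqTPC N β Δt ω =
      (((Real.cosh (β * ω / 2) / Real.sinh (β * ω / 2) - 1 : ℝ) : ℂ) / 2) •
        Matrix.vecMulVec
          (fun k : Finset.Icc (-(N : ℤ)) (N : ℤ) =>
            Complex.exp (Complex.I * ω * ((|(k : ℤ)| : ℤ) : ℝ) * Δt))
          (fun k : Finset.Icc (-(N : ℤ)) (N : ℤ) =>
            starRingEnd ℂ (Complex.exp (Complex.I * ω * ((|(k : ℤ)| : ℤ) : ℝ) * Δt))) +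
      (((Real.cosh (β * ω / 2) / Real.sinh (β * ω / 2) + 1 : ℝ) : ℂ) / 2) •
        Matrix.vecMulVec
          (fun k : Finset.Icc (-(N : ℤ)) (N : ℤ) =>
            Complex.exp (-(Complex.I * ω * ((|(k : ℤ)| : ℤ) : ℝ) * Δt)))
          (fun k : Finset.Icc (-(N : ℤ)) (N : ℤ) =>
            starRingEnd ℂ (Complex.exp (-(Complex.I * ω * ((|(k : ℤ)| : ℤ) : ℝ) * Δt)))) := by
  ext k₁ k₂
  simp only [fixedFreqTPC, Matrix.add_apply, Matrix.smul_apply, Matrix.vecMulVec_apply,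
    smul_eq_mul, exp_mul_conj_exp_phase, exp_neg_mul_conj_exp_neg_phase, Int.cast_sub,
    Complex.ofReal_mul, Complex.ofReal_sub, Complex.ofReal_add, Complex.ofReal_one,
    Complex.ofReal_cos, Complex.ofReal_sin]
  ring
end

section
/- Let N ≥ 1 be an integer, β > 0, Δt > 0 and ω > 0. Then for all ω > 0 (with no further restriction), the fixed-frequency two-point correlation matrix 𝓑(ω) has rank at most 2. -/
open scoped BigOperators

/-- A matrix whose entries are `u₁ i * v₁ j + u₂ i * v₂ j` has rank at most two. -/
theorem Matrix.rank_le_two_of_eq_mul_add_mul {m n R : Type*} [Fintype n] [CommRing R]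
    [StrongRankCondition R] {A : Matrix m n R} (u₁ u₂ : m → R) (v₁ v₂ : n → R)
    (h : ∀ i j, A i j = u₁ i * v₁ j + u₂ i * v₂ j) : A.rank ≤ 2 := by
  have hA : A = Matrix.of (fun i => ![u₁ i, u₂ i]) * Matrix.of ![v₁, v₂] := by
    ext i j
    simp [Matrix.mul_apply, Fin.sum_univ_two, h]
  rw [hA]
  exact (Matrix.rank_mul_le_left _ _).trans (Matrix.rank_le_card_width _)

/-- for all ω > 0 (with no further restriction), the fixed-frequency
two-point correlation matrix 𝓑(ω) has rank at most 2. -/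
theorem fixedFreqTPC_rank_le_two (N : ℕ) (hN : 1 ≤ N) (β Δt : ℝ)
    (hβ : 0 < β) (hΔt : 0 < Δt) :
    ∀ ω : ℝ, 0 < ω → (fixedFreqTPC N β Δt ω).rank ≤ 2 := by
  intro ω _
  let c : ℝ := Real.cosh (β * ω / 2) / Real.sinh (β * ω / 2)
  let θ (k : Finset.Icc (-(N : ℤ)) (N : ℤ)) : ℝ := ω * ((|(k : ℤ)| : ℤ) : ℝ) * Δt
  refine Matrix.rank_le_two_of_eq_mul_add_mul
    (fun k => (Real.cos (θ k) : ℂ)) (fun k => (Real.sin (θ k) : ℂ))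
    (fun k => c * Real.cos (θ k) + Complex.I * Real.sin (θ k))
    (fun k => c * Real.sin (θ k) - Complex.I * Real.cos (θ k)) fun k₁ k₂ => ?_
  have hθ : ω * ((|(k₁ : ℤ)| - |(k₂ : ℤ)| : ℤ) : ℝ) * Δt = θ k₁ - θ k₂ := by
    simp only [θ, Int.cast_sub]
    ring
  rw [fixedFreqTPC, hθ, Real.cos_sub, Real.sin_sub]
  simp only [Complex.ofReal_mul, Complex.ofReal_add, Complex.ofReal_sub, c]
  ring
end

section
/- Let N ≥ 1 be an integer, β > 0 and Δt > 0. Let J : (0, ∞) → ℝ be measurable and suppose the matrix-valued map ω ↦ J(ω)·𝓑(ω) is Bochner integrable on (0, ∞) (with respect to Lebesgue measure, matrices carrying a norm). Then the two-point correlation matrix 𝐁 = (1/π) ∫₀^∞ J(ω)·𝓑(ω) dω has rank at most N+1. -/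
open scoped BigOperators

open MeasureTheory

/-- A matrix whose columns factor through a finite index type has rank at most its cardinality. -/
theorem Matrix.rank_submatrix_id_le_card {m n p : Type*} [Fintype m] [Fintype n] [Fintype p]
    (A : Matrix m p ℂ) (f : n → p) : (A.submatrix id f).rank ≤ Fintype.card p := by
  classical
  have h : A.submatrix id f = A * (1 : Matrix p p ℂ).submatrix id f := by
    ext i j
    simp [Matrix.mul_apply, Matrix.one_apply]
  rw [h]
  exact (Matrix.rank_mul_le_left _ _).trans A.rank_le_card_width

/-- The fixed-frequency correlation matrix depends on its column index only through `|k₂|`. -/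
theorem fixedFreqTPC_congr_right (N : ℕ) (β Δt ω : ℝ)
    (k₁ : Finset.Icc (-(N : ℤ)) (N : ℤ)) {k₂ k₂' : Finset.Icc (-(N : ℤ)) (N : ℤ)}
    (h : |(k₂ : ℤ)| = |(k₂' : ℤ)|) :
    fixedFreqTPC N β Δt ω k₁ k₂ = fixedFreqTPC N β Δt ω k₁ k₂' := by
  simp only [fixedFreqTPC, h]

/-- if J : (0,∞) → ℝ is measurable and ω ↦ J(ω)·𝓑(ω) is integrable on
(0,∞) (equivalently, entrywise integrable), then the two-point correlation matrix
𝐁 = (1/π) ∫₀^∞ J(ω)·𝓑(ω) dω has rank at most N+1. -/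
theorem tpcMatrix_rank_le (N : ℕ) (hN : 1 ≤ N) (β Δt : ℝ)
    (hβ : 0 < β) (hΔt : 0 < Δt) (J : ℝ → ℝ) (hJ : Measurable J)
    (hInt : ∀ k₁ k₂ : Finset.Icc (-(N : ℤ)) (N : ℤ),
      IntegrableOn (fun ω : ℝ => ((J ω : ℝ) : ℂ) * fixedFreqTPC N β Δt ω k₁ k₂)
        (Set.Ioi 0)) :
    (Matrix.of (fun k₁ k₂ : Finset.Icc (-(N : ℤ)) (N : ℤ) =>
        (1 / (Real.pi : ℂ)) *
          ∫ ω in Set.Ioi (0 : ℝ), ((J ω : ℝ) : ℂ) * fixedFreqTPC N β Δt ω k₁ k₂)).rank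
      ≤ N + 1 := by
  let incl (j : Fin (N + 1)) : Finset.Icc (-(N : ℤ)) (N : ℤ) :=
    ⟨(j : ℕ), Finset.mem_Icc.2 ⟨by omega, by omega⟩⟩
  let col (k : Finset.Icc (-(N : ℤ)) (N : ℤ)) : Fin (N + 1) :=
    ⟨(k : ℤ).natAbs, by have := Finset.mem_Icc.1 k.2; omega⟩
  have hcol (k : Finset.Icc (-(N : ℤ)) (N : ℤ)) : |(k : ℤ)| = |(incl (col k) : ℤ)| := by
    simp [incl, col]
  let A : Matrix (Finset.Icc (-(N : ℤ)) (N : ℤ)) (Fin (N + 1)) ℂ := Matrix.of fun k j =>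
    (1 / (Real.pi : ℂ)) *
      ∫ ω in Set.Ioi (0 : ℝ), ((J ω : ℝ) : ℂ) * fixedFreqTPC N β Δt ω k (incl j)
  have h := A.rank_submatrix_id_le_card col
  rw [Fintype.card_fin] at h
  convert h using 2
  ext k₁ k₂
  simp only [A, Matrix.of_apply, Matrix.submatrix_apply, id_eq,
    fixedFreqTPC_congr_right N β Δt _ k₁ (hcol k₂)]
end

section
/- Let N ≥ 1 and L ≥ 1 be integers, β > 0 and Δt > 0. Let ω₁, …, ω_L > 0 be frequencies and c₁, …, c_L ∈ ℝ coupling coefficients, and let the two-point correlation matrix for a harmonic bath of L oscillators be 𝐁 = Σ_{j=1}^L (c_j²/(2·ω_j)) · 𝓑(ω_j). Then the rank of 𝐁 is at most min{N+1, 2L}. -/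
open scoped BigOperators

/-- A matrix whose rows only depend on the image of the row index in a finite type `ι` has rank
at most the cardinality of `ι`. -/
theorem Matrix.rank_le_card_of_row_eq {m n ι R : Type*} [Fintype n] [Fintype ι] [DecidableEq ι]
    [CommSemiring R] [StrongRankCondition R] (M : Matrix m n R) (f : m → ι) (g : ι → n → R)
    (h : ∀ k l, M k l = g (f k) l) : M.rank ≤ Fintype.card ι := by
  have hM : M = Matrix.of (fun k i => if f k = i then (1 : R) else 0) * Matrix.of g := by
    ext k l
    simp [Matrix.mul_apply, h]
  rw [hM]
  exact (Matrix.rank_mul_le_left _ _).trans (Matrix.rank_le_card_width _)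

/-- The angle-difference formulas split each entry of `𝓑(ω)` into two rank-one terms. -/
theorem fixedFreqTPC_apply_eq_add (N : ℕ) (β Δt ω : ℝ)
    (k₁ k₂ : Finset.Icc (-(N : ℤ)) (N : ℤ)) :
    fixedFreqTPC N β Δt ω k₁ k₂ =
      Real.cos (ω * ((|(k₁ : ℤ)| : ℤ) : ℝ) * Δt) *
        ((Real.cosh (β * ω / 2) / Real.sinh (β * ω / 2) : ℝ) *
            Real.cos (ω * ((|(k₂ : ℤ)| : ℤ) : ℝ) * Δt) +
          Complex.I * Real.sin (ω * ((|(k₂ : ℤ)| : ℤ) : ℝ) * Δt)) +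
      Real.sin (ω * ((|(k₁ : ℤ)| : ℤ) : ℝ) * Δt) *
        ((Real.cosh (β * ω / 2) / Real.sinh (β * ω / 2) : ℝ) *
            Real.sin (ω * ((|(k₂ : ℤ)| : ℤ) : ℝ) * Δt) -
          Complex.I * Real.cos (ω * ((|(k₂ : ℤ)| : ℤ) : ℝ) * Δt)) := by
  have hsub : ω * ((|(k₁ : ℤ)| - |(k₂ : ℤ)| : ℤ) : ℝ) * Δt =
      ω * ((|(k₁ : ℤ)| : ℤ) : ℝ) * Δt - ω * ((|(k₂ : ℤ)| : ℤ) : ℝ) * Δt := by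
    rw [Int.cast_sub]
    ring
  unfold fixedFreqTPC
  rw [hsub, Real.cos_sub, Real.sin_sub]
  simp only [Complex.ofReal_mul, Complex.ofReal_add, Complex.ofReal_sub]
  ring

/-- The rank of a linear combination of the `𝓑(ω_j)` is at most `N + 1`, because its rows depend on
`|k₁|` only. -/
theorem rank_sum_smul_fixedFreqTPC_le_succ {ι : Type*} [Fintype ι] (N : ℕ) (β Δt : ℝ)
    (ωs : ι → ℝ) (w : ι → ℂ) :
    (∑ j, w j • fixedFreqTPC N β Δt (ωs j)).rank ≤ N + 1 := by
  have hlt : ∀ k : Finset.Icc (-(N : ℤ)) (N : ℤ), (k : ℤ).natAbs < N + 1 := fun k => by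
    have := Finset.mem_Icc.mp k.2
    omega
  have hmem : ∀ i : Fin (N + 1), (i : ℤ) ∈ Finset.Icc (-(N : ℤ)) (N : ℤ) := fun i => by
    rw [Finset.mem_Icc]
    omega
  refine (Matrix.rank_le_card_of_row_eq _
    (fun k : Finset.Icc (-(N : ℤ)) (N : ℤ) => (⟨(k : ℤ).natAbs, hlt k⟩ : Fin (N + 1)))
    (fun i l => (∑ j, w j • fixedFreqTPC N β Δt (ωs j)) ⟨(i : ℤ), hmem i⟩ l) ?_).trans_eq
    (Fintype.card_fin _)
  intro k l
  simp only [Matrix.sum_apply, Matrix.smul_apply, fixedFreqTPC, Int.natCast_natAbs, abs_abs]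

/-- The rank of a linear combination of the `𝓑(ω_j)` is at most twice the number of
frequencies. -/
theorem rank_sum_smul_fixedFreqTPC_le_two_mul {ι : Type*} [Fintype ι] (N : ℕ) (β Δt : ℝ)
    (ωs : ι → ℝ) (w : ι → ℂ) :
    (∑ j, w j • fixedFreqTPC N β Δt (ωs j)).rank ≤ 2 * Fintype.card ι := by
  let C : ι → ℂ := fun j => (Real.cosh (β * ωs j / 2) / Real.sinh (β * ωs j / 2) : ℝ)
  let x : ι → Finset.Icc (-(N : ℤ)) (N : ℤ) → ℂ := fun j k =>
    Real.cos (ωs j * ((|(k : ℤ)| : ℤ) : ℝ) * Δt)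
  let y : ι → Finset.Icc (-(N : ℤ)) (N : ℤ) → ℂ := fun j k =>
    Real.sin (ωs j * ((|(k : ℤ)| : ℤ) : ℝ) * Δt)
  let A : Matrix (Finset.Icc (-(N : ℤ)) (N : ℤ)) (ι ⊕ ι) ℂ :=
    Matrix.of fun k => Sum.elim (fun j => x j k) (fun j => y j k)
  let B : Matrix (ι ⊕ ι) (Finset.Icc (-(N : ℤ)) (N : ℤ)) ℂ :=
    Matrix.of (Sum.elim (fun j l => w j * (C j * x j l + Complex.I * y j l))
      (fun j l => w j * (C j * y j l - Complex.I * x j l)))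
  have hAB : ∑ j, w j • fixedFreqTPC N β Δt (ωs j) = A * B := by
    ext k l
    simp only [Matrix.sum_apply, Matrix.smul_apply, smul_eq_mul, fixedFreqTPC_apply_eq_add,
      Matrix.mul_apply, Fintype.sum_sum_type, A, B, x, y, C, Matrix.of_apply, Sum.elim_inl,
      Sum.elim_inr, ← Finset.sum_add_distrib]
    exact Finset.sum_congr rfl fun j _ => by ring
  rw [hAB]
  refine ((Matrix.rank_mul_le_left _ _).trans (Matrix.rank_le_card_width _)).trans_eq ?_
  rw [Fintype.card_sum, two_mul]

/-- for a harmonic bath of L oscillators with frequencies ω_j > 0 and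
couplings c_j ∈ ℝ, the two-point correlation matrix
𝐁 = Σ_{j=1}^L (c_j²/(2ω_j))·𝓑(ω_j) has rank at most min{N+1, 2L}. -/
theorem tpcMatrix_discrete_rank_le (N L : ℕ) (hN : 1 ≤ N) (hL : 1 ≤ L)
    (β Δt : ℝ) (hβ : 0 < β) (hΔt : 0 < Δt)
    (ωs : Fin L → ℝ) (hωs : ∀ j, 0 < ωs j) (c : Fin L → ℝ) :
    (∑ j : Fin L, (((c j) ^ 2 / (2 * ωs j) : ℝ) : ℂ) • fixedFreqTPC N β Δt (ωs j)).rank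
      ≤ min (N + 1) (2 * L) := by
  refine le_min (rank_sum_smul_fixedFreqTPC_le_succ N β Δt ωs _) ?_
  simpa only [Fintype.card_fin] using rank_sum_smul_fixedFreqTPC_le_two_mul N β Δt ωs
    fun j => (((c j) ^ 2 / (2 * ωs j) : ℝ) : ℂ)
end

section
/- Let n ≥ 1 and m ≥ 1 be integers, W ∈ ℂ^{n×n}, G : ℤ × ℤ → ℂ^{n×n}, and let w : ℤ × ℤ → ℂ and sgn : ℤ → ℂ be arbitrary functions. Fix integers k_i ≤ k_f. Let L⁽¹⁾, …, L⁽ᵐ⁺¹⁾ be a tensor train with m+1 cores over the index set ℤ and ranks (1, r₁, …, r_m, 1), representing the tensor 𝓛(k₁, …, k_{m+1}) = L⁽¹⁾(k₁)·⋯·L⁽ᵐ⁺¹⁾(k_{m+1}) ∈ ℂ. Define matrices Ω⁽ᵐ⁾(k, α) = W·G(k, k_f)·W · Σ_{α'=1}^{r_m} L⁽ᵐ⁾(α, k, α')·L⁽ᵐ⁺¹⁾(α', k_f, 1) for α ∈ {1, …, r_{m−1}}; for j = m, m−1, …, 1 define I⁽ʲ⁻¹⁾(k, α) = Σ_{k'=k}^{k_f}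 w(k, k')·sgn(k')·Ω⁽ʲ⁾(k', α)·G(k, k') for α ∈ {1, …, r_{j−1}}; and for j = m−1, …, 1 define Ω⁽ʲ⁾(k, α) = Σ_{α'=1}^{r_j} L⁽ʲ⁾(α, k, α')·I⁽ʲ⁾(k, α')·W for α ∈ {1, …, r_{j−1}}. Then I⁽⁰⁾(k_i, 1) = Σ over all integer tuples k_i = k₀ ≤ k₁ ≤ k₂ ≤ ⋯ ≤ k_m ≤ k_f of (Π_{j=1}^m w(k_{j−1}, k_j)·sgn(k_j)) · W·G(k_m, k_f)·W·G(k_{m−1}, k_m)·W·⋯·W·G(k₀, k₁) · 𝓛(k₁, …, k_m, k_f). -/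
open scoped BigOperators

/-- The tensor represented by a tensor train with `m+1` cores over the index set `ℤ`
and ranks `r 0, r 1, …, r (m+1)` (with `r 0 = r (m+1) = 1`).  The cores are given by
their entries `L j k a b` (the `(a, b)` entry of the matrix `L⁽ʲ⁾(k)`, cores numbered
`j = 1, …, m+1`), and the represented tensor is the product
`L⁽¹⁾(k₁)·⋯·L⁽ᵐ⁺¹⁾(k_{m+1})`, written as a sum over all paths of bond indices. -/
noncomputable def ttTensorZ (m : ℕ) (r : ℕ → ℕ) (L : ℕ → ℤ → ℕ → ℕ → ℂ)
    (ks : Fin (m + 1) → ℤ) : ℂ :=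
  ∑ α : ((t : Fin (m + 2)) → Fin (r (t : ℕ))),
    ∏ j : Fin (m + 1), L ((j : ℕ) + 1) (ks j) ((α j.castSucc : ℕ)) ((α j.succ : ℕ))

open Finset

/-- The recursive evaluation of a tensor train with `m + 1` cores and first bond
index `a`, whose core `j` is evaluated at `kk j`. -/
noncomputable def ttFrom :
    ℕ → (ℕ → ℕ) → (ℕ → ℤ → ℕ → ℕ → ℂ) → (ℕ → ℤ) → ℕ → ℂ
  | 0, _, L, kk, a => L 1 (kk 1) a 0
  | m + 1, r, L, kk, a => ∑ b ∈ range (r 1), L 1 (kk 1) a b *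
      ttFrom m (fun i => r (i + 1)) (fun j => L (j + 1)) (fun j => kk (j + 1)) b

theorem ttTensorZ_eq_sum_ttFrom (m : ℕ) (r : ℕ → ℕ) (hr : r (m + 1) = 1)
    (L : ℕ → ℤ → ℕ → ℕ → ℂ) (kk : ℕ → ℤ) :
    ttTensorZ m r L (fun t => kk ((t : ℕ) + 1)) = ∑ a ∈ range (r 0), ttFrom m r L kk a := by
  rw [Finset.sum_range]
  unfold ttTensorZ
  rw [← (Fin.consEquiv fun t : Fin (m + 2) => Fin (r (t : ℕ))).sum_comp, Fintype.sum_prod_type]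
  refine Finset.sum_congr rfl fun a _ => ?_
  induction m generalizing r L kk with
  | zero =>
    have h0 (x : Fin (r 1)) : (x : ℕ) = 0 := by
      have := x.isLt
      simp only [zero_add] at hr
      omega
    let z : (t : Fin 1) → Fin (r ((t.succ : Fin 2) : ℕ)) := fun t =>
      ⟨0, by simp [hr]⟩
    rw [Fintype.sum_eq_single z]
    · simp [ttFrom, Fin.consEquiv, z]
    · intro x hx
      refine (hx ?_).elim
      funext t
      obtain rfl : t = 0 := Subsingleton.elim _ _
      exact Fin.ext (h0 (x 0))
  | succ m ih =>
    rw [← (Fin.consEquiv fun t : Fin (m + 2) => Fin (r ((t.succ : Fin (m + 3)) : ℕ))).sum_comp,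
      Fintype.sum_prod_type, ttFrom, Finset.sum_range]
    refine Finset.sum_congr rfl fun b _ => ?_
    rw [← ih (fun i => r (i + 1)) hr (fun j => L (j + 1)) (fun j => kk (j + 1)) b
        (Finset.mem_univ _),
      Finset.mul_sum]
    refine Finset.sum_congr rfl fun x _ => ?_
    rw [Fin.prod_univ_succ]
    rfl

/-- The nondecreasing integer tuples of length `m` with entries in `[a, b]`. -/
noncomputable def monotoneTuples (m : ℕ) (a b : ℤ) : Finset (Fin m → ℤ) :=
  open Classical in (Fintype.piFinset fun _ => Icc a b).filter Monotone

theorem mem_monotoneTuples {m : ℕ} {a b : ℤ} {ks : Fin m → ℤ} :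
    ks ∈ monotoneTuples m a b ↔ (∀ t, a ≤ ks t ∧ ks t ≤ b) ∧ Monotone ks := by
  simp [monotoneTuples]

theorem sum_monotoneTuples_succ {M : Type*} [AddCommMonoid M] (m : ℕ) (a b : ℤ)
    (f : (Fin (m + 1) → ℤ) → M) :
    ∑ ks ∈ monotoneTuples (m + 1) a b, f ks =
      ∑ k ∈ Icc a b, ∑ ks ∈ monotoneTuples m k b, f (Fin.cons k ks) := by
  rw [Finset.sum_sigma']
  refine (Finset.sum_nbij' (fun p => Fin.cons p.1 p.2) (fun ks => ⟨ks 0, Fin.tail ks⟩)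
    ?_ ?_ ?_ ?_ ?_).symm
  · rintro ⟨k, ks⟩ h
    simp only [Finset.mem_sigma, Finset.mem_Icc, mem_monotoneTuples] at h ⊢
    obtain ⟨⟨h1, h2⟩, h3, h4⟩ := h
    refine ⟨fun t => ?_, fun s t hst => ?_⟩
    · cases t using Fin.cases with
      | zero => exact ⟨h1, h2⟩
      | succ t => exact ⟨h1.trans (h3 t).1, (h3 t).2⟩
    · cases s using Fin.cases with
      | zero =>
        cases t using Fin.cases with
        | zero => exact le_rfl
        | succ t => exact (h3 t).1
      | succ s =>
        cases t using Fin.cases with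
        | zero => exact absurd hst (by simp)
        | succ t => exact h4 (Fin.succ_le_succ_iff.mp hst)
  · intro ks h
    simp only [Finset.mem_sigma, Finset.mem_Icc, mem_monotoneTuples] at h ⊢
    exact ⟨h.1 0, fun t => ⟨h.2 (Fin.zero_le _), (h.1 _).2⟩,
      fun s t hst => h.2 (Fin.succ_le_succ_iff.mpr hst)⟩
  · rintro ⟨k, ks⟩ _
    simp
  · intro ks _
    simp
  · intro p _
    rfl

/-- The tuple `ks`, indexed from `1` to `m`, preceded by `a` and followed by `b`. -/
def padTuple (m : ℕ) (a b : ℤ) (ks : Fin m → ℤ) (j : ℕ) : ℤ :=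
  if h : 1 ≤ j ∧ j ≤ m then ks ⟨j - 1, by omega⟩ else if j = 0 then a else b

theorem padTuple_zero (m : ℕ) (a b : ℤ) (ks : Fin m → ℤ) : padTuple m a b ks 0 = a := by
  simp [padTuple]

theorem padTuple_cons_succ (m : ℕ) (a b k : ℤ) (ks : Fin m → ℤ) (j : ℕ) :
    padTuple (m + 1) a b (Fin.cons k ks) (j + 1) = padTuple m k b ks j := by
  cases j with
  | zero => simp [padTuple]
  | succ j =>
    by_cases h : j + 1 ≤ m
    · simp only [padTuple, Nat.add_sub_cancel, Nat.le_add_left, true_and, h,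
        Nat.add_le_add_iff_right, dite_true]
      exact Fin.cons_succ (α := fun _ => ℤ) k ks ⟨j, h⟩
    · simp [padTuple, h]

section Propagator

variable {n : ℕ} (W : Matrix (Fin n) (Fin n) ℂ) (G : ℤ → ℤ → Matrix (Fin n) (Fin n) ℂ)

/-- The time-ordered product `W * G (k m) (k (m + 1)) * ⋯ * W * G (k 0) (k 1)`. -/
def orderedProd (m : ℕ) (kk : ℕ → ℤ) : Matrix (Fin n) (Fin n) ℂ :=
  ((List.range (m + 1)).map fun j => W * G (kk (m - j)) (kk (m - j + 1))).prod

theorem orderedProd_succ (m : ℕ) (kk : ℕ → ℤ) :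
    orderedProd W G (m + 1) kk =
      orderedProd W G m (fun j => kk (j + 1)) * (W * G (kk 0) (kk 1)) := by
  unfold orderedProd
  rw [List.range_succ, List.map_append, List.prod_append]
  congr 1
  · congr 1
    refine List.map_congr_left fun j hj => ?_
    rw [show m + 1 - j = m - j + 1 by have := List.mem_range.mp hj; omega]
  · simp

theorem sweep_eq_sum_monotoneTuples (w : ℤ → ℤ → ℂ) (sgn : ℤ → ℂ) (kf : ℤ) (m : ℕ)
    (r : ℕ → ℕ) (L : ℕ → ℤ → ℕ → ℕ → ℂ) (J : ℕ → ℤ → ℕ → Matrix (Fin n) (Fin n) ℂ)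
    (hlast : ∀ k a, a < r m → J m k a = L (m + 1) kf a 0 • (W * G k kf))
    (hstep : ∀ j < m, ∀ k a, a < r j → J j k a = ∑ k' ∈ Icc k kf, (w k k' * sgn k') •
      ((∑ b ∈ range (r (j + 1)), L (j + 1) k' a b • (J (j + 1) k' b * W)) * G k k'))
    (k : ℤ) (a : ℕ) (ha : a < r 0) :
    J 0 k a = ∑ ks ∈ monotoneTuples m k kf,
      ((∏ j ∈ range m, w (padTuple m k kf ks j) (padTuple m k kf ks (j + 1)) *
        sgn (padTuple m k kf ks (j + 1))) * ttFrom m r L (padTuple m k kf ks) a) •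
        orderedProd W G m (padTuple m k kf ks) := by
  induction m generalizing r L J k a with
  | zero =>
    rw [hlast k a ha, Finset.sum_eq_single (default : Fin 0 → ℤ)]
    · simp [ttFrom, orderedProd, padTuple]
    · exact fun b _ hb => (hb (Subsingleton.elim _ _)).elim
    · exact fun h => (h (mem_monotoneTuples.mpr ⟨fun t => t.elim0, fun s => s.elim0⟩)).elim
  | succ m ih =>
    rw [hstep 0 m.succ_pos k a ha, sum_monotoneTuples_succ]
    refine Finset.sum_congr rfl fun k' _ => ?_
    have key : ∀ b ∈ range (r (0 + 1)), L (0 + 1) k' a b • (J (0 + 1) k' b * W) = _ :=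
      fun b hb => by
        rw [ih (fun i => r (i + 1)) (fun j => L (j + 1)) (fun j => J (j + 1)) hlast
          (fun j hj => hstep (j + 1) (by omega)) k' b (Finset.mem_range.mp hb)]
    rw [Finset.sum_congr rfl key]
    simp only [Finset.sum_mul, Finset.smul_sum]
    rw [Finset.sum_comm]
    refine Finset.sum_congr rfl fun ks _ => ?_
    simp only [orderedProd_succ, Finset.prod_range_succ', padTuple_cons_succ, padTuple_zero, ttFrom,
      Finset.mul_sum, Finset.sum_smul]
    refine Finset.sum_congr rfl fun b _ => ?_
    simp only [Matrix.smul_mul, smul_smul, Matrix.mul_assoc]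
    congr 1
    ring

end Propagator

/-- correctness of the iterative (sweep) evaluation of the
`m`-dimensional discrete sum with a tensor-train bath influence functional.
If `Ω⁽ᵐ⁾(k, α) = (Σ_{α'} L⁽ᵐ⁾(α,k,α')·L⁽ᵐ⁺¹⁾(α',k_f,1)) • (W·G(k,k_f)·W)`, and for
`j = m, …, 1` one has `I⁽ʲ⁻¹⁾(k, α) = Σ_{k'=k}^{k_f} w(k,k')·sgn(k') • (Ω⁽ʲ⁾(k',α)·G(k,k'))`
and for `j = m−1, …, 1`, `Ω⁽ʲ⁾(k, α) = Σ_{α'} L⁽ʲ⁾(α,k,α') • (I⁽ʲ⁾(k,α')·W)`, then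
`I⁽⁰⁾(k_i, 1)` equals the sum over all monotone tuples
`k_i = k₀ ≤ k₁ ≤ ⋯ ≤ k_m ≤ k_f` of
`(Π_j w(k_{j−1},k_j)·sgn(k_j)) · 𝓛(k₁,…,k_m,k_f) • (W·G(k_m,k_f)·W·G(k_{m−1},k_m)·⋯·W·G(k₀,k₁))`. -/
theorem tt_sequential_integration (n m : ℕ) (hn : 1 ≤ n) (hm : 1 ≤ m)
    (W : Matrix (Fin n) (Fin n) ℂ) (G : ℤ → ℤ → Matrix (Fin n) (Fin n) ℂ)
    (w : ℤ → ℤ → ℂ) (sgn : ℤ → ℂ)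
    (ki kf : ℤ) (hki : ki ≤ kf)
    (r : ℕ → ℕ) (hr0 : r 0 = 1) (hrlast : r (m + 1) = 1)
    (L : ℕ → ℤ → ℕ → ℕ → ℂ)
    (Om Iq : ℕ → ℤ → ℕ → Matrix (Fin n) (Fin n) ℂ)
    (hOmTop : ∀ (k : ℤ) (α : ℕ), α < r (m - 1) →
      Om m k α =
        (∑ α' ∈ Finset.range (r m), L m k α α' * L (m + 1) kf α' 0) •
          (W * G k kf * W))
    (hI : ∀ j : ℕ, 1 ≤ j → j ≤ m → ∀ (k : ℤ) (α : ℕ), α < r (j - 1) →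
      Iq (j - 1) k α =
        ∑ k' ∈ Finset.Icc k kf, (w k k' * sgn k') • (Om j k' α * G k k'))
    (hOmMid : ∀ j : ℕ, 1 ≤ j → j ≤ m - 1 → ∀ (k : ℤ) (α : ℕ), α < r (j - 1) →
      Om j k α =
        ∑ α' ∈ Finset.range (r j), (L j k α α') • (Iq j k α' * W)) :
    Iq 0 ki 0 =
      ∑ ks ∈ Finset.univ.filter
          (fun ks : Fin m → (Finset.Icc ki kf) =>
            ∀ s t : Fin m, s ≤ t → ((ks s : ℤ) ≤ (ks t : ℤ))),
        (fun kk : ℕ → ℤ =>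
            ((∏ j ∈ Finset.range m, w (kk j) (kk (j + 1)) * sgn (kk (j + 1))) *
                ttTensorZ m r L (fun t : Fin (m + 1) => kk ((t : ℕ) + 1))) •
              ((List.range (m + 1)).map
                  (fun j => W * G (kk (m - j)) (kk (m - j + 1)))).prod)
          (fun j : ℕ =>
            if h : 1 ≤ j ∧ j ≤ m then ((ks ⟨j - 1, by omega⟩ : ℤ))
            else if j = 0 then ki else kf) := by
  let J : ℕ → ℤ → ℕ → Matrix (Fin n) (Fin n) ℂ := fun j k a =>
    if j = m then L (m + 1) kf a 0 • (W * G k kf) else Iq j k a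
  have hJm : ∀ k a, J m k a = L (m + 1) kf a 0 • (W * G k kf) := fun k a => if_pos rfl
  have hJ : ∀ j < m, ∀ k a, J j k a = Iq j k a := fun j hj k a => if_neg hj.ne
  have hOm : ∀ j < m, ∀ k a, a < r j → Om (j + 1) k a =
      ∑ b ∈ range (r (j + 1)), L (j + 1) k a b • (J (j + 1) k b * W) := by
    intro j hj k a ha
    obtain rfl | hj' := eq_or_ne (j + 1) m
    · rw [hOmTop k a ha, Finset.sum_smul]
      simp only [hJm, Matrix.smul_mul, smul_smul]
    · rw [hOmMid (j + 1) (by omega) (by omega) k a ha]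
      simp only [hJ (j + 1) (by omega)]
  have main := sweep_eq_sum_monotoneTuples W G w sgn kf m r L J (fun k a _ => hJm k a)
    (fun j hj k a ha => by
      rw [hJ j hj]
      refine (hI (j + 1) (by omega) hj k a ha).trans (Finset.sum_congr rfl fun k' _ => ?_)
      rw [hOm j hj k' a ha]) ki 0 (by omega)
  rw [← hJ 0 hm, main]
  refine (Finset.sum_nbij (fun ks t => (ks t : ℤ)) ?_ ?_ ?_ ?_).symm
  · intro ks h
    exact mem_monotoneTuples.mpr
      ⟨fun t => Finset.mem_Icc.mp (ks t).2, (Finset.mem_filter.mp h).2⟩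
  · intro x _ y _ h
    funext t
    exact Subtype.ext (congrFun h t)
  · intro ks h
    obtain ⟨h1, h2⟩ := mem_monotoneTuples.mp h
    exact ⟨fun t => ⟨ks t, Finset.mem_Icc.mpr (h1 t)⟩,
      Finset.mem_coe.mpr (Finset.mem_filter.mpr ⟨Finset.mem_univ _, h2⟩), rfl⟩
  · intro ks _
    have hT := ttTensorZ_eq_sum_ttFrom m r hrlast L (padTuple m ki kf fun t => (ks t : ℤ))
    rw [hr0, Finset.sum_range_one] at hT
    rw [← hT]
    rfl
end
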